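/- Let X be a complete metric space without isolated points. The collection of nonempty compact subsets of X that are homeomorphic to the Cantor set (equivalently: compact, metrizable, totally disconnected, without isolated points) is residual in the hyperspace K(X) with the Hausdorff metric. -/

import Mathlib

open Set Filter Topology TopologicalSpace

/-- Brouwer: a countable clopen algebra characterisation of the Cantor space. -/
theorem brouwer_aux (Y : Type*) [TopologicalSpace Y] [CompactSpace Y] [T2Space Y]
    [SecondCountableTopology Y] [TotallySeparatedSpace Y] [Nonempty Y]
    (hY : ∀ y : Y, (𝓝[≠] y).NeBot) : Nonempty (Y ≃ₜ (ℕ → Bool)) := by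
  classical
  have hc : Countable (Clopens Y) :=
    Clopens.countable_iff_secondCountable.2 inferInstance
  have : Nonempty (Clopens Y) := ⟨⊤⟩
  obtain ⟨C, hC⟩ := exists_surjective_nat (Clopens Y)
  have sep : ∀ x y : Y, x ≠ y → ∃ n, x ∈ C n ∧ y ∉ C n := by
    intro x y hxy
    obtain ⟨U, hU, hx, hy⟩ := exists_isClopen_of_totally_separated hxy
    obtain ⟨n, hn⟩ := hC ⟨U, hU⟩
    exact ⟨n, by rw [hn]; exact hx, by rw [hn]; exact hy⟩
  have split : ∀ (A : Set Y) (n : ℕ), ∃ S : Set Y, IsClopen S ∧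
      (IsClopen A → A.Nonempty → (A ∩ S).Nonempty ∧ (A ∩ Sᶜ).Nonempty ∧
        ((A ∩ C n).Nonempty → (A ∩ (C n : Set Y)ᶜ).Nonempty → S = C n)) := by
    intro A n
    by_cases h : (A ∩ C n).Nonempty ∧ (A ∩ (C n : Set Y)ᶜ).Nonempty
    · exact ⟨C n, (C n).isClopen, fun _ _ => ⟨h.1, h.2, fun _ _ => rfl⟩⟩
    · by_cases h' : IsClopen A ∧ A.Nonempty
      · obtain ⟨hA, x, hx⟩ := h'
        have hAx : A ∈ 𝓝 x := hA.isOpen.mem_nhds hx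
        have := hY x
        obtain ⟨y, hyA, hyx⟩ := (inter_mem (mem_nhdsWithin_of_mem_nhds hAx)
          (self_mem_nhdsWithin (a := x) (s := {x}ᶜ))  |> Filter.nonempty_of_mem)
        obtain ⟨m, hm, hm'⟩ := sep y x hyx
        exact ⟨C m, (C m).isClopen, fun _ _ => ⟨⟨y, hyA, hm⟩, ⟨x, hx, hm'⟩,
          fun h1 h2 => (h ⟨h1, h2⟩).elim⟩⟩
      · exact ⟨univ, isClopen_univ, fun h1 h2 => (h' ⟨h1, h2⟩).elim⟩
  choose S hS hS' using split
  let T : (ℕ → Bool) → ℕ → Set Y := fun b n => Nat.rec univ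
    (fun k A => A ∩ (if b k then S A k else (S A k)ᶜ)) n
  have T0 : ∀ b, T b 0 = univ := fun b => rfl
  have Ts : ∀ b n, T b (n+1) = T b n ∩ (if b n then S (T b n) n else (S (T b n) n)ᶜ) :=
    fun b n => rfl
  have Tc : ∀ b n, IsClopen (T b n) ∧ (T b n).Nonempty := by
    intro b n
    induction n with
    | zero => exact ⟨isClopen_univ, univ_nonempty⟩
    | succ n ih =>
      rw [Ts]
      have := hS' (T b n) n ih.1 ih.2
      split_ifs
      · exact ⟨ih.1.inter (hS _ _), this.1⟩
      · exact ⟨ih.1.inter (hS _ _).compl, this.2.1⟩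
  have Tdec : ∀ b n, T b (n+1) ⊆ T b n := fun b n => by rw [Ts]; exact inter_subset_left
  have Tres : ∀ n b b', (∀ k < n, b k = b' k) → T b n = T b' n := by
    intro n
    induction n with
    | zero => intros; rfl
    | succ n ih =>
      intro b b' h
      rw [Ts, Ts, ih b b' (fun k hk => h k (by omega)), h n (by omega)]
  have Tdet : ∀ b n, T b (n+1) ⊆ C n ∨ T b (n+1) ⊆ (C n : Set Y)ᶜ := by
    intro b n
    have := (hS' (T b n) n (Tc b n).1 (Tc b n).2).2.2
    by_cases h1 : (T b n ∩ C n).Nonempty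
    · by_cases h2 : (T b n ∩ (C n : Set Y)ᶜ).Nonempty
      · rw [Ts, this h1 h2]
        split_ifs
        · exact Or.inl inter_subset_right
        · exact Or.inr inter_subset_right
      · left
        intro z hz
        by_contra hz'
        exact h2 ⟨z, Tdec _ _ hz, hz'⟩
    · right
      intro z hz hz'
      exact h1 ⟨z, Tdec _ _ hz, hz'⟩
  have hne : ∀ b, (⋂ n, T b n).Nonempty := fun b =>
    IsCompact.nonempty_iInter_of_sequence_nonempty_isCompact_isClosed (T b) (Tdec b)
      (fun n => (Tc b n).2) (Tc b 0).1.isClosed.isCompact (fun n => (Tc b n).1.isClosed)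
  choose g hg using hne
  have hg' : ∀ b n, g b ∈ T b n := fun b n => mem_iInter.1 (hg b) n
  have uniq : ∀ b y, (∀ n, y ∈ T b n) → g b = y := by
    intro b y hy
    by_contra hne
    obtain ⟨n, h1, h2⟩ := sep _ _ hne
    rcases Tdet b n with h | h
    · exact h2 (h (hy (n+1)))
    · exact h (hg' b (n+1)) h1
  have ginj : Function.Injective g := by
    intro b b' hbb
    by_contra hne
    have hex : ∃ n, b n ≠ b' n := Function.ne_iff.1 hne
    have hlt : ∀ k < Nat.find hex, b k = b' k := fun k hk => by
      simpa using Nat.find_min hex hk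
    have hn := Nat.find_spec hex
    set n := Nat.find hex
    have e := Tres n b b' hlt
    have m1 := hg' b (n+1)
    have m2 := hg' b' (n+1)
    rw [Ts] at m1 m2
    rw [← hbb, ← e] at m2
    have m1' := m1.2
    have m2' := m2.2
    cases h1 : b n <;> cases h2 : b' n <;> simp_all
  have gsurj : Function.Surjective g := by
    intro y
    let A : ℕ → Set Y := fun n => Nat.rec univ
      (fun k A => A ∩ (if y ∈ S A k then S A k else (S A k)ᶜ)) n
    have As : ∀ n, A (n+1) = A n ∩ (if y ∈ S (A n) n then S (A n) n else (S (A n) n)ᶜ) :=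
      fun n => rfl
    have hyA : ∀ n, y ∈ A n := by
      intro n
      induction n with
      | zero => exact mem_univ _
      | succ n ih =>
        rw [As]
        refine ⟨ih, ?_⟩
        split_ifs with h
        · exact h
        · exact h
    refine ⟨fun n => decide (y ∈ S (A n) n), uniq _ _ ?_⟩
    have : ∀ n, T (fun n => decide (y ∈ S (A n) n)) n = A n := by
      intro n
      induction n with
      | zero => rfl
      | succ n ih => rw [Ts, ih, As]; simp
    intro n
    rw [this]; exact hyA n
  have gcont : Continuous g := by
    rw [continuous_iff_continuousAt]
    intro b
    rw [ContinuousAt, tendsto_def]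
    intro s hs
    obtain ⟨V, hV, hbV, hVs⟩ := compact_exists_isClopen_in_isOpen isOpen_interior
      (mem_interior_iff_mem_nhds.2 hs)
    obtain ⟨n, hn⟩ := hC ⟨V, hV⟩
    have hCV : (C n : Set Y) = V := by rw [hn]; rfl
    have hsub : T b (n+1) ⊆ V := by
      rw [← hCV]
      rcases Tdet b n with h | h
      · exact h
      · exact absurd (hCV ▸ hbV) (h (hg' b (n+1)))
    have : ∀ᶠ b' in 𝓝 b, ∀ k < n+1, b k = b' k := by
      have : ∀ᶠ b' in 𝓝 b, ∀ k ∈ Set.Iio (n+1), b k = b' k := by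
        rw [eventually_all_finite (Set.finite_Iio _)]
        intro k _
        have : Tendsto (fun b' : ℕ → Bool => b' k) (𝓝 b) (𝓝 (b k)) :=
          (continuous_apply k).tendsto b
        rw [nhds_discrete Bool, tendsto_pure] at this
        exact this.mono fun _ h => h.symm
      exact this
    filter_upwards [this] with b' hb'
    have hm : g b' ∈ T b (n+1) := by rw [Tres (n+1) b b' hb']; exact hg' b' (n+1)
    have hm' : g b' ∈ s := interior_subset (hVs (hsub hm))
    exact hm'
  exact ⟨(Continuous.homeoOfEquivCompactToT2 (f := Equiv.ofBijective g ⟨ginj, gsurj⟩)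
    gcont).symm⟩

theorem W_nhds {X : Type*} [MetricSpace X] {ε : ℝ} (hε : 0 < ε) (K : NonemptyCompacts X)
    (hK : (K : Set X).Finite) :
    ∀ᶠ L : NonemptyCompacts X in 𝓝 K, ∀ x ∈ L, ∃ u v : Set X, IsOpen u ∧ IsOpen v ∧
      Disjoint u v ∧ x ∈ u ∧ (L : Set X) ⊆ u ∪ v ∧ ∀ y ∈ u, dist y x < ε := by
  obtain ⟨U, hU, hd⟩ := hK.t2_separation
  let U' : X → Set X := fun x => U x ∩ Metric.ball x (ε / 2)
  have hU' : ∀ x, IsOpen (U' x) := fun x => (hU x).2.inter Metric.isOpen_ball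
  have hopen : IsOpen (⋃ x ∈ (K : Set X), U' x) := isOpen_biUnion fun x _ => hU' x
  have hmem : (K : Set X) ⊆ ⋃ x ∈ (K : Set X), U' x := fun x hx =>
    mem_biUnion hx ⟨(hU x).1, Metric.mem_ball_self (by positivity)⟩
  filter_upwards [(NonemptyCompacts.isOpen_subsets_of_isOpen hopen).mem_nhds hmem] with L hL x hx
  obtain ⟨a, haK, hxa⟩ := mem_iUnion₂.1 (hL hx)
  refine ⟨U' a, ⋃ b ∈ (K : Set X) \ {a}, U' b, hU' a, isOpen_biUnion fun b _ => hU' b, ?_, hxa,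
    ?_, ?_⟩
  · rw [disjoint_iUnion₂_right]
    intro b hb
    exact (hd haK hb.1 (fun h => hb.2 h.symm)).mono inter_subset_left inter_subset_left
  · intro y hy
    obtain ⟨b, hbK, hyb⟩ := mem_iUnion₂.1 (hL hy)
    by_cases h : b = a
    · left; rwa [← h]
    · right; exact mem_biUnion (show b ∈ (K : Set X) \ {a} from ⟨hbK, h⟩) hyb
  · intro y hy
    have h1 := hy.2
    have h2 := hxa.2
    rw [Metric.mem_ball] at h1 h2
    linarith [dist_triangle_right y x a]

theorem P_nhds {X : Type*} [MetricSpace X] {ε : ℝ} (hε : 0 < ε) (K : NonemptyCompacts X)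
    (hK : (K : Set X).Finite) (hp : ∀ x ∈ K, ∃ y ∈ K, y ≠ x ∧ dist y x < ε) :
    ∀ᶠ L : NonemptyCompacts X in 𝓝 K, ∀ x ∈ L, ∃ y ∈ L, y ≠ x ∧ dist y x < ε := by
  have : ∀ x : X, ∃ U V : Set X, x ∈ K → (IsOpen U ∧ IsOpen V ∧ x ∈ U ∧
      ((K : Set X) ∩ V).Nonempty ∧ ∀ a ∈ U, ∀ b ∈ V, b ≠ a ∧ dist b a < ε) := by
    intro x
    by_cases hx : x ∈ K
    · obtain ⟨y, hy, hyx, hd⟩ := hp x hx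
      have ho : IsOpen {p : X × X | p.2 ≠ p.1 ∧ dist p.2 p.1 < ε} :=
        (isOpen_ne_fun continuous_snd continuous_fst).inter
          (isOpen_lt (continuous_snd.dist continuous_fst) continuous_const)
      obtain ⟨U, V, hU, hV, hxU, hyV, hUV⟩ := isOpen_prod_iff.1 ho x y ⟨hyx, hd⟩
      exact ⟨U, V, fun _ => ⟨hU, hV, hxU, ⟨y, hy, hyV⟩, fun a ha b hb => hUV (mk_mem_prod ha hb)⟩⟩
    · exact ⟨∅, ∅, fun h => (hx h).elim⟩
  choose U V h using this
  have hopen : IsOpen (⋃ x ∈ (K : Set X), U x) := isOpen_biUnion fun x hx => (h x hx).1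
  have hmem : (K : Set X) ⊆ ⋃ x ∈ (K : Set X), U x := fun x hx =>
    mem_biUnion hx (h x hx).2.2.1
  have hV : ∀ᶠ L : NonemptyCompacts X in 𝓝 K, ∀ x ∈ (K : Set X), ((L : Set X) ∩ V x).Nonempty := by
    rw [eventually_all_finite hK]
    intro x hx
    exact (NonemptyCompacts.isOpen_inter_nonempty_of_isOpen (h x hx).2.1).mem_nhds (h x hx).2.2.2.1
  filter_upwards [(NonemptyCompacts.isOpen_subsets_of_isOpen hopen).mem_nhds hmem, hV]
    with L hL hLV x hx
  obtain ⟨a, haK, hxa⟩ := mem_iUnion₂.1 (hL hx)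
  obtain ⟨b, hbL, hb⟩ := hLV a haK
  exact ⟨b, hbL, (h a haK).2.2.2.2 x hxa b hb⟩

theorem dense_good {X : Type*} [MetricSpace X] (hX : ∀ x : X, (𝓝[≠] x).NeBot)
    {ε : ℝ} (hε : 0 < ε) : Dense {K : NonemptyCompacts X | (K : Set X).Finite ∧
      ∀ x ∈ K, ∃ y ∈ K, y ≠ x ∧ dist y x < ε} := by
  intro K₀
  rw [Metric.mem_closure_iff]
  intro δ hδ
  obtain ⟨K, hK, hKd⟩ := Metric.mem_closure_iff.1
    (NonemptyCompacts.dense_setOfPred_finite K₀) (δ / 2) (by positivity)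
  have hm : 0 < min ε (δ / 4) := lt_min hε (by positivity)
  have : ∀ x : X, ∃ y, y ≠ x ∧ dist y x < min ε (δ / 4) := by
    intro x
    have := hX x
    obtain ⟨y, hy, hyx⟩ := Filter.nonempty_of_mem (inter_mem
      (mem_nhdsWithin_of_mem_nhds (Metric.ball_mem_nhds x hm))
      (self_mem_nhdsWithin (a := x) (s := {x}ᶜ)))
    exact ⟨y, hyx, hy⟩
  choose f hf hfd using this
  have hfin : ((K : Set X) ∪ f '' K).Finite := Set.Finite.union hK (Set.Finite.image f hK)
  let L : NonemptyCompacts X := ⟨⟨(K : Set X) ∪ f '' K, hfin.isCompact⟩,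
    K.nonempty.mono subset_union_left⟩
  have hL : ∀ x, x ∈ L ↔ x ∈ K ∨ ∃ z ∈ K, f z = x := fun x => Iff.rfl
  refine ⟨L, ⟨hfin, ?_⟩, ?_⟩
  · intro x hx
    rcases (hL x).1 hx with h | ⟨z, hz, rfl⟩
    · exact ⟨f x, (hL _).2 (Or.inr ⟨x, h, rfl⟩), hf x, (hfd x).trans_le (min_le_left _ _)⟩
    · refine ⟨z, (hL _).2 (Or.inl hz), (hf z).symm, ?_⟩
      rw [dist_comm]
      exact (hfd z).trans_le (min_le_left _ _)
  · have : dist K L ≤ δ / 4 := by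
      rw [Metric.NonemptyCompacts.dist_eq]
      apply Metric.hausdorffDist_le_of_mem_dist (by positivity)
      · intro x hx
        exact ⟨x, Or.inl hx, by rw [dist_self]; positivity⟩
      · intro x hx
        rcases hx with h | ⟨z, hz, rfl⟩
        · exact ⟨x, h, by rw [dist_self]; positivity⟩
        · exact ⟨z, hz, (hfd z).le.trans (min_le_right _ _)⟩
    linarith [dist_triangle K₀ K L]

theorem residual_of_dense_nhds {Z : Type*} [TopologicalSpace Z] {D P : Set Z} (hD : Dense D)
    (h : ∀ z ∈ D, P ∈ 𝓝 z) : P ∈ residual Z :=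
  mem_of_superset (residual_of_dense_open isOpen_interior
    (hD.mono fun z hz => mem_interior_iff_mem_nhds.2 (h z hz))) interior_subset

/-- In a complete metric space without isolated points, the collection of nonempty
compact subsets homeomorphic to the Cantor space is residual in the hyperspace with
the Hausdorff metric. -/
theorem cantor_sets_residual {X : Type*} [MetricSpace X] [CompleteSpace X]
    (hX : ∀ x : X, (nhdsWithin x {x}ᶜ).NeBot) :
    {K : TopologicalSpace.NonemptyCompacts X |
        Nonempty ((K : Set X) ≃ₜ (ℕ → Bool))} ∈
      residual (TopologicalSpace.NonemptyCompacts X) := by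
  have h1 : ∀ᶠ L : NonemptyCompacts X in residual _, ∀ n : ℕ,
      ∀ x ∈ L, ∃ u v : Set X, IsOpen u ∧ IsOpen v ∧
      Disjoint u v ∧ x ∈ u ∧ (L : Set X) ⊆ u ∪ v ∧ ∀ y ∈ u, dist y x < 1 / ((n : ℝ) + 1) :=
    eventually_countable_forall.2 fun n =>
      residual_of_dense_nhds NonemptyCompacts.dense_setOfPred_finite
        fun K hK => W_nhds Nat.one_div_pos_of_nat K hK
  have h2 : ∀ᶠ L : NonemptyCompacts X in residual _, ∀ n : ℕ,
      ∀ x ∈ L, ∃ y ∈ L, y ≠ x ∧ dist y x < 1 / ((n : ℝ) + 1) :=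
    eventually_countable_forall.2 fun n =>
      residual_of_dense_nhds (dense_good hX Nat.one_div_pos_of_nat)
        fun K hK => P_nhds Nat.one_div_pos_of_nat K hK.1 hK.2
  filter_upwards [h1, h2] with K hK1 hK2
  have : CompactSpace (K : Set X) := isCompact_iff_compactSpace.1 K.isCompact
  have : Nonempty (K : Set X) := K.nonempty.to_subtype
  have : TotallySeparatedSpace (K : Set X) := by
    refine ⟨fun x _ y _ hxy => ?_⟩
    obtain ⟨n, hn⟩ := exists_nat_one_div_lt (dist_pos.2 hxy)
    obtain ⟨u, v, hu, hv, hd, hxu, hc, hb⟩ := hK1 n x x.2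
    refine ⟨Subtype.val ⁻¹' u, Subtype.val ⁻¹' v, hu.preimage continuous_subtype_val,
      hv.preimage continuous_subtype_val, hxu, ?_, fun z _ => hc z.2, hd.preimage _⟩
    rcases hc y.2 with h | h
    · have := hb _ h
      rw [dist_comm] at this
      exact absurd (hn.trans this) (lt_irrefl _)
    · exact h
  refine brouwer_aux (K : Set X) fun x => ?_
  rw [← mem_closure_iff_nhdsWithin_neBot, Metric.mem_closure_iff]
  intro ε hε
  obtain ⟨n, hn⟩ := exists_nat_one_div_lt hε
  obtain ⟨y, hy, hyx, hd⟩ := hK2 n x x.2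
  refine ⟨⟨y, hy⟩, fun h => hyx (congrArg Subtype.val h), ?_⟩
  rw [dist_comm]
  exact lt_trans hd hn
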